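/- Let L be a lattice of rank n ≥ 7 and let (v_1,…,v_n) be any Minkowski-reduced basis of L. Then ‖v_7‖² ≤ (7/4)·λ_7(L)². -/

import Mathlib

open scoped BigOperators
noncomputable section

/-- Euclidean space ℝ^m. -/
abbrev E (m : ℕ) := EuclideanSpace ℝ (Fin m)

/-- `L` is a lattice of rank `n` in `ℝ^m`: a discrete additive subgroup spanning an
`n`-dimensional real subspace. -/
def IsLattice {m : ℕ} (L : AddSubgroup (E m)) (n : ℕ) : Prop :=
  DiscreteTopology L ∧ Module.finrank ℝ (Submodule.span ℝ (L : Set (E m))) = n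

/-- `b` is a basis of the lattice `L`: a tuple of vectors of `L` generating `L`
as a ℤ-module. -/
def IsLatticeBasis {m n : ℕ} (L : AddSubgroup (E m)) (b : Fin n → E m) : Prop :=
  (∀ i, b i ∈ L) ∧ (Submodule.span ℤ (Set.range b) : Set (E m)) = (L : Set (E m))

/-- `b` is a primitive tuple of vectors of `L`: it is linearly independent and
`span_ℤ(b) = span_ℝ(b) ∩ L`; equivalently, it can be extended to a basis of `L`. -/
def IsPrimitiveTuple {m k : ℕ} (L : AddSubgroup (E m)) (b : Fin k → E m) : Prop :=
  (∀ i, b i ∈ L) ∧ LinearIndependent ℝ b ∧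
  (Submodule.span ℤ (Set.range b) : Set (E m)) =
    (Submodule.span ℝ (Set.range b) : Set (E m)) ∩ (L : Set (E m))

/-- The first `i` entries of the tuple `v`. -/
def truncTuple {m n : ℕ} (v : Fin n → E m) (i : Fin n) : Fin i → E m :=
  fun j => v (Fin.castLE i.isLt.le j)

/-- `v` is a Minkowski-reduced basis of `L`: it is a basis and, for each `i`, `v i` has
minimal norm among all `w ∈ L` such that `(v 0, …, v (i-1), w)` is primitive. -/
def IsMinkowskiReduced {m n : ℕ} (L : AddSubgroup (E m)) (v : Fin n → E m) : Prop :=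
  IsLatticeBasis L v ∧ ∀ i : Fin n, ∀ w ∈ L,
    IsPrimitiveTuple L (Fin.snoc (truncTuple v i) w) → ‖v i‖ ≤ ‖w‖

/-- The `i`-th successive minimum `λ_i(L)`: the least `r ≥ 0` such that `L` contains
`i` linearly independent vectors of norm at most `r`. -/
def succMin {m : ℕ} (L : AddSubgroup (E m)) (i : ℕ) : ℝ :=
  sInf {r : ℝ | 0 ≤ r ∧ ∃ v : Fin i → E m,
    (∀ j, v j ∈ L) ∧ LinearIndependent ℝ v ∧ ∀ j, ‖v j‖ ≤ r}

theorem mem_span_image_iff_exists_coeff {R M : Type*} [Ring R] [AddCommGroup M] [Module R M]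
    {n : ℕ} (v : Fin n → M) (s : Set (Fin n)) (y : M) :
    y ∈ Submodule.span R (v '' s) ↔
      ∃ c : Fin n → R, (∀ j, j ∉ s → c j = 0) ∧ y = ∑ j, c j • v j := by
  constructor
  · intro hy
    induction hy using Submodule.span_induction with
    | mem x hx =>
      obtain ⟨j, hj, rfl⟩ := hx
      refine ⟨Pi.single j 1, ?_, ?_⟩
      · intro l hl
        refine Pi.single_eq_of_ne ?_ _
        rintro rfl
        exact hl hj
      · rw [Finset.sum_eq_single j]
        · simp
        · intro l _ hl
          simp [hl]
        · simp
    | zero => exact ⟨0, by simp, by simp⟩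
    | add x z _ _ hx hz =>
      obtain ⟨c, hc, rfl⟩ := hx
      obtain ⟨d, hd, rfl⟩ := hz
      refine ⟨c + d, fun j hj => by simp [hc j hj, hd j hj], ?_⟩
      simp [add_smul, Finset.sum_add_distrib]
    | smul r x _ hx =>
      obtain ⟨c, hc, rfl⟩ := hx
      refine ⟨r • c, fun j hj => by simp [hc j hj], ?_⟩
      simp [Finset.smul_sum, mul_smul]
  · rintro ⟨c, hc, rfl⟩
    refine Submodule.sum_mem _ fun j _ => ?_
    by_cases hj : j ∈ s
    · exact Submodule.smul_mem _ _ (Submodule.subset_span ⟨j, hj, rfl⟩)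
    · simp [hc j hj]

theorem LinearIndependent.coeff_ext {K M : Type*} [Field K] [AddCommGroup M] [Module K M]
    {n : ℕ} {v : Fin n → M} (hv : LinearIndependent K v) {a b : Fin n → K}
    (h : ∑ j, a j • v j = ∑ j, b j • v j) (j : Fin n) : a j = b j := by
  have h0 : ∑ j, (a j - b j) • v j = 0 := by
    simp [sub_smul, Finset.sum_sub_distrib, h]
  exact sub_eq_zero.1 (Fintype.linearIndependent_iff.1 hv _ h0 j)

theorem sum_smul_mem_span_image_iff {K M : Type*} [Field K] [AddCommGroup M] [Module K M]
    {n : ℕ} {v : Fin n → M} (hv : LinearIndependent K v) (s : Set (Fin n)) (a : Fin n → K) :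
    ∑ j, a j • v j ∈ Submodule.span K (v '' s) ↔ ∀ j, j ∉ s → a j = 0 := by
  rw [mem_span_image_iff_exists_coeff]
  constructor
  · rintro ⟨c, hc, h⟩ j hj
    rw [hv.coeff_ext h j, hc j hj]
  · exact fun h => ⟨a, h, rfl⟩

theorem range_truncTuple {m n : ℕ} (v : Fin n → E m) (i : Fin n) :
    Set.range (truncTuple v i) = v '' Set.Iio i := by
  ext x
  constructor
  · rintro ⟨j, rfl⟩
    exact ⟨Fin.castLE i.isLt.le j, by simp [Fin.lt_def], rfl⟩
  · rintro ⟨j, hj, rfl⟩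
    exact ⟨⟨j, hj⟩, rfl⟩

theorem IsLatticeBasis.exists_coeff {m n : ℕ} {L : AddSubgroup (E m)} {v : Fin n → E m}
    (hb : IsLatticeBasis L v) {w : E m} (hw : w ∈ L) :
    ∃ a : Fin n → ℤ, w = ∑ j, (a j : ℝ) • v j := by
  have h : w ∈ Submodule.span ℤ (Set.range v) := by
    rw [← SetLike.mem_coe, hb.2]
    exact hw
  obtain ⟨a, rfl⟩ := (Submodule.mem_span_range_iff_exists_fun ℤ).1 h
  exact ⟨a, by simp [Int.cast_smul_eq_zsmul]⟩

theorem IsLatticeBasis.sum_mem {m n : ℕ} {L : AddSubgroup (E m)} {v : Fin n → E m}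
    (hb : IsLatticeBasis L v) (a : Fin n → ℤ) : ∑ j, (a j : ℝ) • v j ∈ L := by
  refine AddSubgroup.sum_mem _ fun j _ => ?_
  rw [Int.cast_smul_eq_zsmul]
  exact L.zsmul_mem (hb.1 j) _

theorem IsLatticeBasis.linearIndependent {m n : ℕ} {L : AddSubgroup (E m)} {v : Fin n → E m}
    (hb : IsLatticeBasis L v) (hL : IsLattice L n) : LinearIndependent ℝ v := by
  rw [linearIndependent_iff_card_eq_finrank_span, Fintype.card_fin, Set.finrank]
  have hspan : Submodule.span ℝ (Set.range v) = Submodule.span ℝ (L : Set (E m)) := by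
    refine le_antisymm (Submodule.span_mono (Set.range_subset_iff.2 hb.1))
      (Submodule.span_le.2 fun w hw => ?_)
    obtain ⟨a, rfl⟩ := hb.exists_coeff hw
    exact Submodule.sum_mem _ fun j _ =>
      Submodule.smul_mem _ _ (Submodule.subset_span (Set.mem_range_self j))
  rw [hspan]
  exact hL.2.symm

/-- The tuple `(v 0, …, v (i-1), ∑ j, a j • v j)` is primitive as soon as the coefficients `a j`
with `i ≤ j` are coprime. -/
theorem IsLatticeBasis.isPrimitiveTuple_snoc {m n : ℕ} {L : AddSubgroup (E m)} {v : Fin n → E m}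
    (hb : IsLatticeBasis L v) (hv : LinearIndependent ℝ v) (i : Fin n) (a t : Fin n → ℤ)
    (ht : ∑ j ∈ Finset.Ici i, t j * a j = 1) :
    IsPrimitiveTuple L (Fin.snoc (truncTuple v i) (∑ j, (a j : ℝ) • v j)) := by
  have hrange : Set.range (Fin.snoc (truncTuple v i) (∑ j, (a j : ℝ) • v j) : Fin (i + 1) → E m) =
      insert (∑ j, (a j : ℝ) • v j) (v '' Set.Iio i) := by
    rw [← range_truncTuple, Fin.range_snoc]
  refine ⟨?_, ?_, ?_⟩
  · intro l
    refine Fin.lastCases ?_ (fun l => ?_) l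
    · rw [Fin.snoc_last]
      exact hb.sum_mem a
    · rw [Fin.snoc_castSucc]
      exact hb.1 _
  · rw [linearIndependent_finSnoc, range_truncTuple, sum_smul_mem_span_image_iff hv]
    refine ⟨hv.comp _ (Fin.castLE_injective _), fun h => ?_⟩
    have h0 : ∑ j ∈ Finset.Ici i, t j * a j = 0 := by
      refine Finset.sum_eq_zero fun j hj => ?_
      have := h j (by simpa using hj)
      rw [Int.cast_eq_zero.1 this, mul_zero]
    omega
  · rw [hrange]
    apply Set.Subset.antisymm
    · intro y hy
      refine ⟨Submodule.span_le_restrictScalars ℤ ℝ _ hy, ?_⟩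
      have hle : Submodule.span ℤ (insert (∑ j, (a j : ℝ) • v j) (v '' Set.Iio i)) ≤
          AddSubgroup.toIntSubmodule L := by
        refine Submodule.span_le.2 (Set.insert_subset (hb.sum_mem a) ?_)
        rintro _ ⟨j, _, rfl⟩
        exact hb.1 j
      exact hle hy
    · rintro y ⟨hy, hyL⟩
      obtain ⟨b, rfl⟩ := hb.exists_coeff hyL
      obtain ⟨r, z, hz, hyz⟩ := Submodule.mem_span_insert.1 hy
      obtain ⟨c, hc, rfl⟩ := (mem_span_image_iff_exists_coeff v _ z).1 hz
      have hcoef : ∀ j, (b j : ℝ) = r * a j + c j := by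
        refine fun j => hv.coeff_ext (a := fun j => (b j : ℝ)) (b := fun j => r * a j + c j) ?_ j
        rw [hyz]
        simp [add_smul, Finset.sum_add_distrib, Finset.smul_sum, mul_smul]
      set k : ℤ := ∑ j ∈ Finset.Ici i, t j * b j with hk
      have hr : r = k := by
        have h1 : (k : ℝ) = ∑ j ∈ Finset.Ici i, r * ((t j : ℝ) * a j) := by
          rw [hk]
          push_cast
          refine Finset.sum_congr rfl fun j hj => ?_
          rw [hcoef j, hc j (by simpa using hj)]
          ring
        have h2 : (∑ j ∈ Finset.Ici i, (t j : ℝ) * a j) = 1 := by exact_mod_cast ht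
        rw [h1, ← Finset.mul_sum, h2, mul_one]
      refine Submodule.mem_span_insert.2 ⟨k, ∑ j, (b j - k * a j) • v j, ?_, ?_⟩
      · refine (mem_span_image_iff_exists_coeff v _ _).2 ⟨fun j => b j - k * a j, ?_, rfl⟩
        intro j hj
        have := hcoef j
        rw [hc j hj, hr, add_zero] at this
        have h3 : b j = k * a j := by exact_mod_cast this
        simp [h3]
      · rw [← Int.cast_smul_eq_zsmul ℝ, Finset.smul_sum, ← Finset.sum_add_distrib]
        refine Finset.sum_congr rfl fun j _ => ?_
        rw [← Int.cast_smul_eq_zsmul ℝ (b j - k * a j), smul_smul, ← add_smul]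
        push_cast
        ring_nf

/-- Rounding each coefficient of `∑ l, c l • y l` up or down at random changes the expected squared
norm by at most the sum of the variances. -/
theorem exists_int_norm_sq_add_sum_le {F ι : Type*} [NormedAddCommGroup F] [InnerProductSpace ℝ F]
    (s : Finset ι) (z : F) (c : ι → ℝ) (y : ι → F) :
    ∃ b : ι → ℤ, ‖z + ∑ l ∈ s, (c l + b l) • y l‖ ^ 2 ≤
      ‖z‖ ^ 2 + ∑ l ∈ s, Int.fract (c l) * (1 - Int.fract (c l)) * ‖y l‖ ^ 2 := by
  classical
  induction s using Finset.induction_on with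
  | empty => exact ⟨0, by simp⟩
  | insert l s hl ih =>
    obtain ⟨b, hb⟩ := ih
    set p := z + ∑ l ∈ s, (c l + b l) • y l with hp
    have key : ∃ e : ℤ, ‖p + (c l + e) • y l‖ ^ 2 ≤
        ‖p‖ ^ 2 + Int.fract (c l) * (1 - Int.fract (c l)) * ‖y l‖ ^ 2 := by
      have hexp : ∀ r : ℝ, ‖p + r • y l‖ ^ 2 =
          ‖p‖ ^ 2 + 2 * (r * inner ℝ p (y l)) + r ^ 2 * ‖y l‖ ^ 2 := by
        intro r
        rw [norm_add_sq_real, norm_smul, mul_pow, inner_smul_right]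
        simp
      have h0 := Int.fract_nonneg (c l)
      have h1 := (Int.fract_lt_one (c l)).le
      have hfl : c l = ⌊c l⌋ + Int.fract (c l) := (Int.floor_add_fract _).symm
      set θ := Int.fract (c l) with hθ
      rcases le_total (2 * inner ℝ p (y l)) (((1 - θ) - θ) * ‖y l‖ ^ 2) with h | h
      · refine ⟨-⌊c l⌋, ?_⟩
        have : c l + ((-⌊c l⌋ : ℤ) : ℝ) = θ := by push_cast; linarith
        rw [this, hexp]
        nlinarith [mul_le_mul_of_nonneg_left h h0]
      · refine ⟨-⌊c l⌋ - 1, ?_⟩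
        have : c l + ((-⌊c l⌋ - 1 : ℤ) : ℝ) = θ - 1 := by push_cast; linarith
        rw [this, hexp]
        nlinarith [mul_le_mul_of_nonneg_left h (sub_nonneg.2 h1)]
    obtain ⟨e, he⟩ := key
    refine ⟨Function.update b l e, ?_⟩
    rw [Finset.sum_insert hl, Finset.sum_insert hl, Function.update_self]
    have : ∑ x ∈ s, (c x + (Function.update b l e x : ℤ)) • y x = ∑ x ∈ s, (c x + b x) • y x := by
      refine Finset.sum_congr rfl fun x hx => ?_
      rw [Function.update_of_ne (ne_of_mem_of_not_mem hx hl)]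
    rw [this, add_comm ((c l + (e : ℝ)) • y l), ← add_assoc, ← hp]
    linarith

theorem fract_mul_one_sub_fract_nonneg (c : ℝ) : 0 ≤ Int.fract c * (1 - Int.fract c) :=
  mul_nonneg (Int.fract_nonneg c) (sub_nonneg.2 (Int.fract_lt_one c).le)

theorem fract_mul_one_sub_fract_le (c : ℝ) : Int.fract c * (1 - Int.fract c) ≤ 1 / 4 := by
  nlinarith [sq_nonneg (2 * Int.fract c - 1)]

theorem fract_mul_one_sub_fract_intCast (a : ℤ) :
    Int.fract (a : ℝ) * (1 - Int.fract (a : ℝ)) = 0 := by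
  simp

theorem fract_mul_one_sub_fract_div_three_le (a : ℤ) :
    Int.fract ((a : ℝ) / 3) * (1 - Int.fract ((a : ℝ) / 3)) ≤ 2 / 9 := by
  have h0 := Int.fract_nonneg ((a : ℝ) / 3)
  have h1 := Int.fract_lt_one ((a : ℝ) / 3)
  have h : 3 * Int.fract ((a : ℝ) / 3) = ((a - 3 * ⌊(a : ℝ) / 3⌋ : ℤ) : ℝ) := by
    rw [Int.fract]
    push_cast
    ring
  generalize a - 3 * ⌊(a : ℝ) / 3⌋ = N at h
  have hN0 : 0 ≤ N := by
    have : (0 : ℝ) ≤ N := by linarith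
    exact_mod_cast this
  have hN3 : N < 3 := by
    have : (N : ℝ) < 3 := by linarith
    exact_mod_cast this
  have hθ : Int.fract ((a : ℝ) / 3) = N / 3 := by linarith
  rw [hθ]
  interval_cases N <;> norm_num

theorem IsMinkowskiReduced.norm_sq_le {m n : ℕ} {L : AddSubgroup (E m)} {v : Fin n → E m}
    (hv : IsMinkowskiReduced L v) (hli : LinearIndependent ℝ v) (i : Fin n) (a t : Fin n → ℤ)
    (ht : ∑ j ∈ Finset.Ici i, t j * a j = 1) {ι : Type*} (s : Finset ι) (z : E m) (c : ι → ℝ)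
    (y : ι → E m) (hyL : ∀ l, y l ∈ L) (hyV : ∀ l ∈ s, y l ∈ Submodule.span ℝ (v '' Set.Iio i))
    (h : ∑ j, (a j : ℝ) • v j = z + ∑ l ∈ s, c l • y l) :
    ‖v i‖ ^ 2 ≤
      ‖z‖ ^ 2 + ∑ l ∈ s, Int.fract (c l) * (1 - Int.fract (c l)) * ‖y l‖ ^ 2 := by
  obtain ⟨e, he⟩ := exists_int_norm_sq_add_sum_le s z c y
  refine le_trans ?_ he
  choose b hb using fun l => hv.1.exists_coeff (hyL l)
  have hb0 : ∀ l ∈ s, ∀ j, i ≤ j → b l j = 0 := by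
    intro l hl j hj
    have := hyV l hl
    rw [hb l, sum_smul_mem_span_image_iff hli] at this
    exact_mod_cast this j (by simpa using hj)
  have heq : z + ∑ l ∈ s, (c l + e l) • y l =
      ∑ j, ((a j + ∑ l ∈ s, e l * b l j : ℤ) : ℝ) • v j := by
    have h2 : ∑ l ∈ s, (e l : ℝ) • y l = ∑ j, ((∑ l ∈ s, e l * b l j : ℤ) : ℝ) • v j := by
      have : ∀ l ∈ s, (e l : ℝ) • y l = ∑ j, ((e l * b l j : ℤ) : ℝ) • v j := by
        intro l _
        conv_lhs => rw [hb l, Finset.smul_sum]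
        simp [mul_smul]
      rw [Finset.sum_congr rfl this, Finset.sum_comm]
      simp [Finset.sum_smul]
    simp only [add_smul, Finset.sum_add_distrib, Int.cast_add]
    rw [← add_assoc, ← h, h2]
  rw [heq]
  have hprim := hv.1.isPrimitiveTuple_snoc hli i (fun j => a j + ∑ l ∈ s, e l * b l j) t (by
    rw [← ht]
    refine Finset.sum_congr rfl fun j hj => ?_
    rw [Finset.sum_eq_zero fun l hl => by rw [hb0 l hl j (by simpa using hj), mul_zero], add_zero])
  have := hv.2 i _ (hv.1.sum_mem _) hprim
  gcongr

theorem exists_eq_mul_coprime {n : ℕ} (i : Fin n) (a : Fin n → ℤ) (ha : ∃ j, i ≤ j ∧ a j ≠ 0) :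
    ∃ (k : ℤ) (a' t : Fin n → ℤ), 1 ≤ k ∧ (∀ j, i ≤ j → a j = k * a' j) ∧
      (∀ j, j < i → a' j = 0) ∧ ∑ j ∈ Finset.Ici i, t j * a' j = 1 := by
  obtain ⟨j₀, hj₀, hne⟩ := ha
  obtain ⟨t, ht⟩ := Finset.gcd_eq_sum_mul (Finset.Ici i) a
  set k := (Finset.Ici i).gcd a with hk
  have hk0 : k ≠ 0 := Finset.gcd_ne_zero_iff.2 ⟨j₀, by simpa using hj₀, hne⟩
  have hknn : 0 ≤ k := Finset.Int.finsetGcd_nonneg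
  have hdvd : ∀ j, i ≤ j → a j = k * (a j / k) := fun j hj =>
    (Int.mul_ediv_cancel' (Finset.gcd_dvd (by simpa using hj))).symm
  refine ⟨k, fun j => if j < i then 0 else a j / k, t, by omega, ?_, ?_, ?_⟩
  · intro j hj
    simp only [not_lt.2 hj, if_false]
    exact hdvd j hj
  · intro j hj
    simp [hj]
  · refine mul_left_cancel₀ hk0 ?_
    rw [mul_one, Finset.mul_sum]
    conv_rhs => rw [ht]
    refine Finset.sum_congr rfl fun j hj => ?_
    have hj' : i ≤ j := by simpa using hj
    simp only [not_lt.2 hj', if_false]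
    conv_rhs => rw [hdvd j hj']
    ring

/-- If `v i` is long compared with the short vector `w` outside the span of `v 0, …, v (i-1)`, then
`w` is congruent to `v 0 + ⋯ + v (i-1)` modulo `2 L`. -/
theorem IsMinkowskiReduced.parity_of_lt_norm_sq {m n : ℕ} {L : AddSubgroup (E m)}
    {v : Fin n → E m} (hv : IsMinkowskiReduced L v) (hli : LinearIndependent ℝ v) (i : Fin n)
    {r D : ℝ} (δ : Fin n → ℝ) (hδ1 : ∀ j, 1 ≤ δ j)
    (hδv : ∀ j, j < i → ‖v j‖ ^ 2 ≤ δ j * r ^ 2)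
    (hδs : ∑ j ∈ Finset.Iio i, δ j ≤ (i : ℕ) + 3 / 4)
    (hD1 : 1 ≤ D) (hDi : ((i : ℕ) + 1) / 4 ≤ D) (hlt : D * r ^ 2 < ‖v i‖ ^ 2)
    (a : Fin n → ℤ) (hw : ‖∑ j, (a j : ℝ) • v j‖ ≤ r)
    (hwV : ∑ j, (a j : ℝ) • v j ∉ Submodule.span ℝ (v '' Set.Iio i)) :
    0 < (i : ℕ) ∧ (∀ j, j < i → Odd (a j)) ∧ ∀ j, i ≤ j → Even (a j) := by
  have hne : ∃ j, i ≤ j ∧ a j ≠ 0 := by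
    by_contra! h
    refine hwV ((sum_smul_mem_span_image_iff hli _ _).2 fun j hj => ?_)
    rw [h j (by simpa using hj), Int.cast_zero]
  obtain ⟨k, a', t, hk1, hak, ha', ht⟩ := exists_eq_mul_coprime i a hne
  set w := ∑ j, (a j : ℝ) • v j with hwdef
  have hkR : (1 : ℝ) ≤ k := by exact_mod_cast hk1
  have hk0 : (k : ℝ) ≠ 0 := by positivity
  have hw2 : ‖w‖ ^ 2 ≤ r ^ 2 := by gcongr
  have hr2 : 0 ≤ r ^ 2 := sq_nonneg r
  have hi0 : (0 : ℝ) ≤ (i : ℕ) := by positivity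
  have hdecomp : ∑ j, (a' j : ℝ) • v j =
      (k : ℝ)⁻¹ • w + ∑ j ∈ Finset.Iio i, (((-a j : ℤ) : ℝ) / k) • v j := by
    have hfull : ∑ j ∈ Finset.Iio i, (((-a j : ℤ) : ℝ) / k) • v j =
        ∑ j, (if j < i then ((-a j : ℤ) : ℝ) / k else 0) • v j := by
      rw [← Finset.sum_subset (Finset.subset_univ (Finset.Iio i)) (by simp +contextual)]
      refine Finset.sum_congr rfl fun j hj => ?_
      rw [if_pos (by simpa using hj)]
    rw [hfull, hwdef, Finset.smul_sum, ← Finset.sum_add_distrib]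
    refine Finset.sum_congr rfl fun j _ => ?_
    rw [smul_smul, ← add_smul]
    congr 1
    split_ifs with hj
    · rw [ha' j hj]
      push_cast
      ring
    · rw [hak j (not_lt.1 hj)]
      push_cast
      field_simp
      simp
  have hbound := hv.norm_sq_le hli i a' t ht (Finset.Iio i) _ _ v hv.1.1
    (fun l hl => Submodule.subset_span ⟨l, by simpa using hl, rfl⟩) hdecomp
  rw [norm_smul, mul_pow, norm_inv, Real.norm_eq_abs, inv_pow, sq_abs] at hbound
  have hsum : ∀ C : ℝ, 0 ≤ C → (∀ j, j < i →
      Int.fract (((-a j : ℤ) : ℝ) / k) * (1 - Int.fract (((-a j : ℤ) : ℝ) / k)) ≤ C) →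
      ∑ j ∈ Finset.Iio i, Int.fract (((-a j : ℤ) : ℝ) / k) *
        (1 - Int.fract (((-a j : ℤ) : ℝ) / k)) * ‖v j‖ ^ 2 ≤ C * (((i : ℕ) + 3 / 4) * r ^ 2) := by
    intro C hC h
    calc _ ≤ ∑ j ∈ Finset.Iio i, C * (δ j * r ^ 2) := by
          refine Finset.sum_le_sum fun j hj => ?_
          have hj' : j < i := by simpa using hj
          exact mul_le_mul (h j hj') (hδv j hj') (sq_nonneg _) hC
      _ = C * ((∑ j ∈ Finset.Iio i, δ j) * r ^ 2) := by
          rw [Finset.sum_mul, Finset.mul_sum]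
      _ ≤ _ := by gcongr
  have hDr : r ^ 2 ≤ D * r ^ 2 := le_mul_of_one_le_left hr2 hD1
  have hDir : ((i : ℕ) + 1) / 4 * r ^ 2 ≤ D * r ^ 2 := mul_le_mul_of_nonneg_right hDi hr2
  have hir : 0 ≤ ((i : ℕ) : ℝ) * r ^ 2 := by positivity
  have hk2 : k = 2 := by
    by_contra hk2
    obtain rfl | rfl | hk4 : k = 1 ∨ k = 3 ∨ 4 ≤ k := by omega
    · have := hsum 0 le_rfl fun j _ => by
        rw [Int.cast_one, div_one, fract_mul_one_sub_fract_intCast]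
      norm_num at hbound this
      linarith
    · have := hsum (2 / 9) (by norm_num) fun j _ => by
        exact_mod_cast fract_mul_one_sub_fract_div_three_le (-a j)
      norm_num at hbound this
      linarith
    · have := hsum (1 / 4) (by norm_num) fun j _ => fract_mul_one_sub_fract_le _
      have hk4' : (4 : ℝ) ≤ k := by exact_mod_cast hk4
      have h16 : ((k : ℝ) ^ 2)⁻¹ * ‖w‖ ^ 2 ≤ (4 ^ 2)⁻¹ * r ^ 2 := by gcongr
      linarith
  subst hk2
  refine ⟨?_, ?_, fun j hj => ⟨a' j, by rw [hak j hj]; ring⟩⟩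
  · by_contra hi
    have hi' : ((i : ℕ) : ℝ) = 0 := by exact_mod_cast Nat.eq_zero_of_not_pos hi
    have := hsum (1 / 4) (by norm_num) fun j _ => fract_mul_one_sub_fract_le _
    rw [hi'] at this
    norm_num at hbound this
    linarith
  · intro j₀ hj₀
    rw [← Int.not_even_iff_odd]
    rintro ⟨q, hq⟩
    have hmem : j₀ ∈ Finset.Iio i := by simpa using hj₀
    have h0 : Int.fract (((-a j₀ : ℤ) : ℝ) / (2 : ℤ)) = 0 := by
      have : ((-a j₀ : ℤ) : ℝ) / (2 : ℤ) = ((-q : ℤ) : ℝ) := by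
        rw [hq]
        push_cast
        ring
      rw [this, Int.fract_intCast]
    rw [← Finset.add_sum_erase _ _ hmem, h0] at hbound
    have hle : ∑ j ∈ (Finset.Iio i).erase j₀, Int.fract (((-a j : ℤ) : ℝ) / (2 : ℤ)) *
        (1 - Int.fract (((-a j : ℤ) : ℝ) / (2 : ℤ))) * ‖v j‖ ^ 2 ≤
        1 / 4 * (((i : ℕ) - 1 / 4) * r ^ 2) := by
      calc _ ≤ ∑ j ∈ (Finset.Iio i).erase j₀, 1 / 4 * (δ j * r ^ 2) := by
            refine Finset.sum_le_sum fun j hj => ?_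
            have hj' : j < i := by simpa using (Finset.mem_erase.1 hj).2
            exact mul_le_mul (fract_mul_one_sub_fract_le _) (hδv j hj') (sq_nonneg _)
              (by norm_num)
        _ = 1 / 4 * ((∑ j ∈ (Finset.Iio i).erase j₀, δ j) * r ^ 2) := by
            rw [Finset.sum_mul, Finset.mul_sum]
        _ ≤ _ := by
            have := Finset.add_sum_erase (Finset.Iio i) δ hmem
            have := hδ1 j₀
            gcongr
            linarith
    norm_num at hbound hle
    linarith

theorem norm_half_add_le {F : Type*} [NormedAddCommGroup F] [InnerProductSpace ℝ F] {x w : F}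
    {r : ℝ} (hx : ‖x‖ ≤ r) (hw : ‖w‖ ≤ r) : ‖(1 / 2 : ℝ) • (x + w)‖ ≤ r := by
  rw [norm_smul]
  norm_num
  linarith [norm_add_le x w]

/-- Under the hypotheses of `IsMinkowskiReduced.parity_of_lt_norm_sq`, any short vector `x` is
congruent to a multiple of `w`, modulo the line through a short lattice vector `y` of the span of
`v 0, …, v (i-1)`. -/
theorem IsLatticeBasis.exists_short_mem_span {m n : ℕ} {L : AddSubgroup (E m)}
    {v : Fin n → E m} (hb : IsLatticeBasis L v) (i : Fin n) {r : ℝ}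
    (hpar : ∀ a : Fin n → ℤ, ‖∑ j, (a j : ℝ) • v j‖ ≤ r →
      ∑ j, (a j : ℝ) • v j ∉ Submodule.span ℝ (v '' Set.Iio i) →
      0 < (i : ℕ) ∧ (∀ j, j < i → Odd (a j)) ∧ ∀ j, i ≤ j → Even (a j))
    {w x : E m} (hwL : w ∈ L) (hw : ‖w‖ ≤ r) (hwV : w ∉ Submodule.span ℝ (v '' Set.Iio i))
    (hxL : x ∈ L) (hx : ‖x‖ ≤ r) :
    ∃ y ∈ L, y ∈ Submodule.span ℝ (v '' Set.Iio i) ∧ ‖y‖ ≤ r ∧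
      ∃ p q : ℝ, x = p • y + q • w := by
  by_cases hxV : x ∈ Submodule.span ℝ (v '' Set.Iio i)
  · exact ⟨x, hxL, hxV, hx, 1, 0, by simp⟩
  obtain ⟨a, rfl⟩ := hb.exists_coeff hwL
  obtain ⟨b, rfl⟩ := hb.exists_coeff hxL
  obtain ⟨hi, ha1, ha2⟩ := hpar a hw hwV
  obtain ⟨-, hb1, hb2⟩ := hpar b hx hxV
  have hplus : ∀ j, ∃ c, b j + a j = 2 * c := by
    intro j
    rcases lt_or_ge j i with hj | hj
    · exact ((hb1 j hj).add_odd (ha1 j hj)).two_dvd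
    · exact ((hb2 j hj).add (ha2 j hj)).two_dvd
  choose c hc using hplus
  have hminus : ∀ j, b j - a j = 2 * (c j - a j) := fun j => by linarith [hc j]
  set w := ∑ j, (a j : ℝ) • v j with hwdef
  set x := ∑ j, (b j : ℝ) • v j with hxdef
  have hcsum : ∑ j, (c j : ℝ) • v j = (1 / 2 : ℝ) • (x + w) := by
    rw [hwdef, hxdef, ← Finset.sum_add_distrib, Finset.smul_sum]
    refine Finset.sum_congr rfl fun j _ => ?_
    rw [← add_smul, smul_smul]
    have : (b j : ℝ) + a j = 2 * c j := by exact_mod_cast hc j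
    rw [this]
    ring_nf
  have hdsum : ∑ j, ((c j - a j : ℤ) : ℝ) • v j = (1 / 2 : ℝ) • (x + -w) := by
    simp only [Int.cast_sub, sub_smul, Finset.sum_sub_distrib]
    rw [hcsum, ← hwdef]
    module
  have hcr := norm_half_add_le hx hw
  have hdr := norm_half_add_le hx (w := -w) (by rwa [norm_neg])
  by_cases hcV : (1 / 2 : ℝ) • (x + w) ∈ Submodule.span ℝ (v '' Set.Iio i)
  · exact ⟨_, hcsum ▸ hb.sum_mem c, hcV, hcr, 2, -1, by module⟩
  by_cases hdV : (1 / 2 : ℝ) • (x + -w) ∈ Submodule.span ℝ (v '' Set.Iio i)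
  · exact ⟨_, hdsum ▸ hb.sum_mem fun j => c j - a j, hdV, hdr, 2, 1, by module⟩
  exfalso
  rw [← hcsum] at hcr hcV
  rw [← hdsum] at hdr hdV
  have hlt : (⟨0, by omega⟩ : Fin n) < i := by simpa [Fin.lt_def] using hi
  have h1 := (hpar c hcr hcV).2.1 _ hlt
  have h2 := (hpar (fun j => c j - a j) hdr hdV).2.1 _ hlt
  have h3 := ha1 _ hlt
  rw [← Int.not_even_iff_odd] at h2
  exact h2 (h1.sub_odd h3)

theorem IsMinkowskiReduced.norm_sq_le_of_forall_lt {m n : ℕ} {L : AddSubgroup (E m)}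
    {v : Fin n → E m} (hv : IsMinkowskiReduced L v) (hli : LinearIndependent ℝ v) (i : Fin n)
    (hi : (i : ℕ) < 7) {r D : ℝ} (δ : Fin n → ℝ) (hδ1 : ∀ j, 1 ≤ δ j)
    (hδv : ∀ j, j < i → ‖v j‖ ^ 2 ≤ δ j * r ^ 2)
    (hδs : ∑ j ∈ Finset.Iio i, δ j ≤ (i : ℕ) + 3 / 4)
    (hD1 : 1 ≤ D) (hDi : ((i : ℕ) + 1) / 4 ≤ D) (x : Fin 7 → E m) (hxL : ∀ l, x l ∈ L)
    (hx : LinearIndependent ℝ x) (hxr : ∀ l, ‖x l‖ ≤ r) : ‖v i‖ ^ 2 ≤ D * r ^ 2 := by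
  by_contra! hlt
  have hpar := hv.parity_of_lt_norm_sq hli i δ hδ1 hδv hδs hD1 hDi hlt
  set V := Submodule.span ℝ (v '' Set.Iio i) with hV
  have hVrank : Module.finrank ℝ V ≤ i := by
    have := finrank_range_le_card (R := ℝ) (truncTuple v i)
    rwa [Set.finrank, range_truncTuple, Fintype.card_fin] at this
  have hxrank : Module.finrank ℝ (Submodule.span ℝ (Set.range x)) = 7 := by
    rw [finrank_span_eq_card hx, Fintype.card_fin]
  obtain ⟨l₀, hl₀⟩ : ∃ l, x l ∉ V := by
    by_contra! h
    have := Submodule.finrank_mono (Submodule.span_le.2 (Set.range_subset_iff.2 h))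
    omega
  have hex : ∀ l, ∃ y ∈ L, y ∈ V ∧ ‖y‖ ≤ r ∧ (l = l₀ → y = 0) ∧
      ∃ p q : ℝ, x l = p • y + q • x l₀ := by
    intro l
    by_cases hl : l = l₀
    · refine ⟨0, L.zero_mem, V.zero_mem, ?_, fun _ => rfl, 0, 1, by simp [hl]⟩
      rw [norm_zero]
      exact (norm_nonneg _).trans (hxr l₀)
    · obtain ⟨y, hyL, hyV, hyr, h⟩ :=
        hv.1.exists_short_mem_span i hpar (hxL l₀) (hxr l₀) hl₀ (hxL l) (hxr l)
      exact ⟨y, hyL, hyV, hyr, fun h => absurd h hl, h⟩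
  choose y hyL hyV hyr hy0 p q hpq using hex
  have hspan : Submodule.span ℝ (Set.range y) = V := by
    refine Submodule.eq_of_le_of_finrank_le (Submodule.span_le.2 (Set.range_subset_iff.2 hyV)) ?_
    have hle : Submodule.span ℝ (Set.range x) ≤
        Submodule.span ℝ (Set.range y) ⊔ Submodule.span ℝ {x l₀} := by
      refine Submodule.span_le.2 (Set.range_subset_iff.2 fun l => ?_)
      rw [hpq l]
      exact Submodule.add_mem_sup
        (Submodule.smul_mem _ _ (Submodule.subset_span (Set.mem_range_self l)))
        (Submodule.smul_mem _ _ (Submodule.mem_span_singleton_self _))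
    have h1 := Submodule.finrank_mono hle
    have h2 := Submodule.finrank_add_le_finrank_add_finrank (Submodule.span ℝ (Set.range y))
      (Submodule.span ℝ {x l₀})
    have h3 : Module.finrank ℝ (Submodule.span ℝ {x l₀}) ≤ 1 := by
      simpa using finrank_span_le_card (R := ℝ) ({x l₀} : Set (E m))
    omega
  have hi6 : (i : ℕ) = 6 := by
    have hle : Submodule.span ℝ (Set.range x) ≤ V ⊔ Submodule.span ℝ {x l₀} := by
      refine Submodule.span_le.2 (Set.range_subset_iff.2 fun l => ?_)
      rw [hpq l]
      exact Submodule.add_mem_sup (Submodule.smul_mem _ _ (hyV l))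
        (Submodule.smul_mem _ _ (Submodule.mem_span_singleton_self _))
    have h1 := Submodule.finrank_mono hle
    have h2 := Submodule.finrank_add_le_finrank_add_finrank V (Submodule.span ℝ {x l₀})
    have h3 : Module.finrank ℝ (Submodule.span ℝ {x l₀}) ≤ 1 := by
      simpa using finrank_span_le_card (R := ℝ) ({x l₀} : Set (E m))
    omega
  obtain ⟨a, ha⟩ := hv.1.exists_coeff (hxL l₀)
  obtain ⟨-, -, heven⟩ := hpar a (ha ▸ hxr l₀) (ha ▸ hl₀)
  have hne : ∃ j, i ≤ j ∧ a j ≠ 0 := by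
    by_contra! h
    refine hl₀ ?_
    rw [ha, hV, sum_smul_mem_span_image_iff hli]
    intro j hj
    rw [h j (by simpa using hj), Int.cast_zero]
  obtain ⟨k, a', t, hk1, hak, ha', ht⟩ := exists_eq_mul_coprime i a hne
  have hk2 : 2 ≤ k := by
    by_contra hk
    obtain rfl : k = 1 := by omega
    have : (2 : ℤ) ∣ ∑ j ∈ Finset.Ici i, t j * a' j := by
      refine Finset.dvd_sum fun j hj => Dvd.dvd.mul_left ?_ _
      have hj' : i ≤ j := by simpa using hj
      have := hak j hj'
      rw [one_mul] at this
      exact this ▸ (heven j hj').two_dvd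
    omega
  have hkR : (2 : ℝ) ≤ k := by exact_mod_cast hk2
  have hk0 : (k : ℝ) ≠ 0 := by positivity
  have hres : ∑ j, (a' j : ℝ) • v j - (k : ℝ)⁻¹ • x l₀ ∈ V := by
    rw [ha, Finset.smul_sum, ← Finset.sum_sub_distrib]
    simp only [smul_smul, ← sub_smul]
    rw [hV, sum_smul_mem_span_image_iff hli]
    intro j hj
    rw [hak j (by simpa using hj)]
    push_cast
    field_simp
    simp
  rw [← hspan] at hres
  obtain ⟨c, hc⟩ := (Submodule.mem_span_range_iff_exists_fun ℝ).1 hres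
  have hbound := hv.norm_sq_le hli i a' t ht Finset.univ ((k : ℝ)⁻¹ • x l₀) c y hyL
    (fun l _ => hyV l) (by rw [hc]; abel)
  rw [norm_smul, mul_pow, norm_inv, Real.norm_eq_abs, inv_pow, sq_abs] at hbound
  have hsum : ∑ l, Int.fract (c l) * (1 - Int.fract (c l)) * ‖y l‖ ^ 2 ≤
      ∑ l, if l = l₀ then 0 else 1 / 4 * r ^ 2 := by
    refine Finset.sum_le_sum fun l _ => ?_
    split_ifs with hl
    · simp [hy0 l hl]
    · have := hyr l
      exact mul_le_mul (fract_mul_one_sub_fract_le _) (by gcongr) (sq_nonneg _) (by norm_num)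
  have h6 : (∑ l : Fin 7, if l = l₀ then (0 : ℝ) else 1 / 4 * r ^ 2) = 6 * (1 / 4 * r ^ 2) := by
    rw [Finset.sum_ite]
    simp [Finset.filter_ne']
  have h4 : ((k : ℝ) ^ 2)⁻¹ * ‖x l₀‖ ^ 2 ≤ (2 ^ 2)⁻¹ * r ^ 2 := by
    have := hxr l₀
    gcongr
  have hDir := mul_le_mul_of_nonneg_right hDi (sq_nonneg r)
  rw [hi6] at hDir
  norm_num at hDir
  linarith

theorem IsMinkowskiReduced.norm_sq_le_max {m n : ℕ} {L : AddSubgroup (E m)}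
    {v : Fin n → E m} (hv : IsMinkowskiReduced L v) (hli : LinearIndependent ℝ v) {r : ℝ}
    (x : Fin 7 → E m) (hxL : ∀ l, x l ∈ L) (hx : LinearIndependent ℝ x) (hxr : ∀ l, ‖x l‖ ≤ r)
    (i : Fin n) (hi : (i : ℕ) < 7) : ‖v i‖ ^ 2 ≤ max (1 : ℝ) (((i : ℕ) + 1) / 4) * r ^ 2 := by
  induction i using WellFoundedLT.induction with
  | ind i ih =>
    refine hv.norm_sq_le_of_forall_lt hli i hi (fun j => max 1 (((j : ℕ) + 1) / 4))
      (fun j => le_max_left _ _) (fun j hj => ih j hj (lt_trans hj hi)) ?_ (le_max_left _ _)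
      (le_max_right _ _) x hxL hx hxr
    have hmap : ∑ j ∈ Finset.Iio i, max (1 : ℝ) (((j : ℕ) + 1) / 4) =
        ∑ j ∈ Finset.range i, max (1 : ℝ) ((j + 1) / 4) := by
      rw [← Nat.Iio_eq_range, ← Fin.map_valEmbedding_Iio, Finset.sum_map]
      rfl
    rw [hmap]
    generalize (i : ℕ) = N at hi
    interval_cases N <;> norm_num [Finset.sum_range_succ, max_def]

/-- If `L` is a lattice of rank `n ≥ 7` and `v` is any Minkowski-reduced
basis of `L`, then `‖v_7‖² ≤ (7/4)·λ_7(L)²`. -/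
theorem minkowski_seventh_vector_bound {m n : ℕ} (L : AddSubgroup (E m))
    (hL : IsLattice L n) (hn : 7 ≤ n) (v : Fin n → E m)
    (hv : IsMinkowskiReduced L v) :
    ‖v ⟨6, by omega⟩‖ ^ 2 ≤ (7 / 4 : ℝ) * (succMin L 7) ^ 2 := by
  have hli := hv.1.linearIndependent hL
  have hle : √(4 / 7) * ‖v ⟨6, by omega⟩‖ ≤ succMin L 7 := by
    refine le_csInf ?_ ?_
    · refine ⟨∑ j, ‖v j‖, by positivity, fun l => v (Fin.castLE hn l), fun l => hv.1.1 _,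
        hli.comp _ (Fin.castLE_injective hn), fun l => ?_⟩
      exact Finset.single_le_sum (f := fun j => ‖v j‖) (fun j _ => norm_nonneg _)
        (Finset.mem_univ _)
    · rintro r ⟨hr, x, hxL, hx, hxr⟩
      have h := hv.norm_sq_le_max hli x hxL hx hxr ⟨6, by omega⟩ (by norm_num)
      refine abs_le_of_sq_le_sq' ?_ hr |>.2
      rw [mul_pow, Real.sq_sqrt (by norm_num)]
      norm_num at h
      linarith
  have h := pow_le_pow_left₀ (by positivity) hle 2
  rw [mul_pow, Real.sq_sqrt (by norm_num)] at h
  linarith
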